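/- Let F be a subfield of ℝ closed under real square roots (√c ∈ F whenever 0 ≤ c ∈ F), let k ∈ ℕ₀, let ε > 0, and let f : (0, ε) → ℝ. Assume f is represented on (0, ε) by a well-defined expression over F of square-root depth at most k, where such expressions are generated recursively: elements of F and the variable x are expressions of depth 0; sums, differences and products of expressions are expressions of depth equal to the maximum of the depths; quotients e₁/e₂ are expressions of depth max(depth e₁, depth e₂), provided the value of e₂ is nonzero at every point of (0, ε); and √e is an expression of depth (depth e) + 1, provided the value of e is nonnegative at every point of (0, ε), its value being the nonnegative square root. Then there exist t ∈ ℤ, elements b_t, b_{t+1}, b_{t+2}, … of F, and 0 < ε' ≤ ε such that for every x ∈ (0, ε') the series Σ_{j=t}^∞ b_j·x^{j·2^{−k}} converges to f(x). Moreover, if f is not identically zero on any right neighborhood of 0, then one can take b_t ≠ 0, and then t and all the coefficients b_j are uniquely determined. -/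

import Mathlib

open Filter

/-- Expressions over a subfield `F` of `ℝ` built from constants in `F`, the variable `x`,
the four arithmetic operations and the square root. -/
inductive SqExpr (F : Subfield ℝ) : Type
  | const : F → SqExpr F
  | var : SqExpr F
  | add : SqExpr F → SqExpr F → SqExpr F
  | sub : SqExpr F → SqExpr F → SqExpr F
  | mul : SqExpr F → SqExpr F → SqExpr F
  | div : SqExpr F → SqExpr F → SqExpr F
  | sqrt : SqExpr F → SqExpr F

namespace SqExpr

variable {F : Subfield ℝ}

/-- The square-root depth of an expression. -/
def depth : SqExpr F → ℕ
  | const _ => 0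
  | var => 0
  | add e₁ e₂ => max e₁.depth e₂.depth
  | sub e₁ e₂ => max e₁.depth e₂.depth
  | mul e₁ e₂ => max e₁.depth e₂.depth
  | div e₁ e₂ => max e₁.depth e₂.depth
  | sqrt e => e.depth + 1

/-- The value of an expression at a real number (with Lean's junk values `x/0 = 0` and
`√c = 0` for `c < 0`; these junk cases are excluded by `WellDefOn`). -/
noncomputable def val : SqExpr F → ℝ → ℝ
  | const c, _ => (c : ℝ)
  | var, x => x
  | add e₁ e₂, x => e₁.val x + e₂.val x
  | sub e₁ e₂, x => e₁.val x - e₂.val x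
  | mul e₁ e₂, x => e₁.val x * e₂.val x
  | div e₁ e₂, x => e₁.val x / e₂.val x
  | sqrt e, x => Real.sqrt (e.val x)

/-- An expression is well defined on a set `s` if every denominator is nonzero on `s`
and every subexpression under a square root is nonnegative on `s`. -/
def WellDefOn : SqExpr F → Set ℝ → Prop
  | const _, _ => True
  | var, _ => True
  | add e₁ e₂, s => e₁.WellDefOn s ∧ e₂.WellDefOn s
  | sub e₁ e₂, s => e₁.WellDefOn s ∧ e₂.WellDefOn s
  | mul e₁ e₂, s => e₁.WellDefOn s ∧ e₂.WellDefOn s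
  | div e₁ e₂, s => e₁.WellDefOn s ∧ e₂.WellDefOn s ∧ ∀ x ∈ s, e₂.val x ≠ 0
  | sqrt e, s => e.WellDefOn s ∧ ∀ x ∈ s, 0 ≤ e.val x

end SqExpr

/-- `ExpandsOn f k t b ε'` says that on `(0, ε')` the generalized power series
`Σ_{j=t}^∞ b_j · x^{j·2^{−k}}` (with dyadic exponents) converges to `f x`. -/
def ExpandsOn (f : ℝ → ℝ) (k : ℕ) (t : ℤ) (b : ℤ → ℝ) (ε' : ℝ) : Prop :=
  ∀ x ∈ Set.Ioo (0 : ℝ) ε',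
    Tendsto (fun N : ℕ => ∑ j ∈ Finset.range N,
        b (t + j) * x ^ (((t + j : ℤ) : ℝ) / 2 ^ k))
      atTop (nhds (f x))

open Topology

theorem tendsto_pow_nhdsGT_zero {n : ℕ} (hn : n ≠ 0) :
    Tendsto (fun y : ℝ => y ^ n) (𝓝[>] 0) (𝓝[>] 0) := by
  refine tendsto_nhdsWithin_iff.2 ⟨?_, ?_⟩
  · simpa [hn] using ((continuous_pow n).tendsto (0 : ℝ)).mono_left nhdsWithin_le_nhds
  · filter_upwards [self_mem_nhdsWithin] with y hy
    exact pow_pos (Set.mem_Ioi.1 hy) n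

theorem tendsto_rpow_nhdsGT_zero {a : ℝ} (ha : 0 < a) :
    Tendsto (fun x : ℝ => x ^ a) (𝓝[>] 0) (𝓝[>] 0) := by
  refine tendsto_nhdsWithin_iff.2 ⟨?_, ?_⟩
  · have h := (Real.continuousAt_rpow_const 0 a (.inr ha.le)).tendsto
    rw [Real.zero_rpow ha.ne'] at h
    exact h.mono_left nhdsWithin_le_nhds
  · filter_upwards [self_mem_nhdsWithin] with x hx
    exact Real.rpow_pos_of_pos hx _

/-- `g` is analytic at `0` and all its derivatives at `0` lie in `F`. -/
def HasTaylorIn (F : Subfield ℝ) (g : ℝ → ℝ) : Prop :=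
  AnalyticAt ℝ g 0 ∧ ∀ n, iteratedDeriv n g 0 ∈ F

/-- On a right neighborhood of `0`, `φ` is an integer power of the variable times a function
that is analytic at `0` with derivatives in `F`. -/
def HasLaurentIn (F : Subfield ℝ) (φ : ℝ → ℝ) : Prop :=
  ∃ (t : ℤ) (g : ℝ → ℝ), HasTaylorIn F g ∧ φ =ᶠ[𝓝[>] 0] fun y => y ^ t * g y

theorem HasFPowerSeriesAt.iteratedDeriv_eq_factorial_mul_coeff {g : ℝ → ℝ}
    {p : FormalMultilinearSeries ℝ ℝ ℝ} (hp : HasFPowerSeriesAt g p 0) (n : ℕ) :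
    iteratedDeriv n g 0 = n.factorial * p.coeff n := by
  have h := hp.analyticAt.hasFPowerSeriesAt.eq_formalMultilinearSeries hp
  rw [← h, FormalMultilinearSeries.coeff_ofScalars]
  field_simp

/-- Leibniz rule for membership of derivatives in a subfield. -/
theorem iteratedDeriv_mul_mem {F : Subfield ℝ} {u v : ℝ → ℝ} {n : ℕ}
    (hu : AnalyticAt ℝ u 0) (hv : AnalyticAt ℝ v 0)
    (hun : ∀ i ≤ n, iteratedDeriv i u 0 ∈ F) (hvn : ∀ i ≤ n, iteratedDeriv i v 0 ∈ F) :
    iteratedDeriv n (u * v) 0 ∈ F := by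
  rw [iteratedDeriv_mul hu.contDiffAt hv.contDiffAt]
  refine sum_mem fun i hi => ?_
  have hi' : i < n + 1 := Finset.mem_range.1 hi
  exact mul_mem (mul_mem (natCast_mem _ _) (hun _ (by omega))) (hvn _ (by omega))

namespace HasTaylorIn

variable {F : Subfield ℝ} {g h : ℝ → ℝ}

theorem of_hasFPowerSeriesAt {p : FormalMultilinearSeries ℝ ℝ ℝ}
    (hp : HasFPowerSeriesAt g p 0) (hF : ∀ n, p.coeff n ∈ F) : HasTaylorIn F g :=
  ⟨hp.analyticAt, fun n => by
    rw [hp.iteratedDeriv_eq_factorial_mul_coeff]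
    exact mul_mem (natCast_mem _ _) (hF n)⟩

theorem exists_hasFPowerSeriesAt (hg : HasTaylorIn F g) :
    ∃ p : FormalMultilinearSeries ℝ ℝ ℝ, HasFPowerSeriesAt g p 0 ∧ ∀ n, p.coeff n ∈ F := by
  refine ⟨_, hg.1.hasFPowerSeriesAt, fun n => ?_⟩
  rw [FormalMultilinearSeries.coeff_ofScalars]
  exact div_mem (hg.2 n) (natCast_mem _ _)

theorem apply_zero_mem (hg : HasTaylorIn F g) : g 0 ∈ F := by
  simpa using hg.2 0

theorem const {c : ℝ} (hc : c ∈ F) : HasTaylorIn F fun _ => c := by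
  refine ⟨analyticAt_const, fun n => ?_⟩
  rw [iteratedDeriv_const]
  split_ifs
  exacts [hc, zero_mem _]

theorem id : HasTaylorIn F fun y => y := by
  refine ⟨analyticAt_id, fun n => ?_⟩
  rcases n with _ | n
  · simp
  · rw [iteratedDeriv_succ', show deriv (fun y : ℝ => y) = fun _ => 1 from deriv_id'']
    exact (const (one_mem F)).2 n

theorem add (hg : HasTaylorIn F g) (hh : HasTaylorIn F h) : HasTaylorIn F (g + h) :=
  ⟨hg.1.add hh.1, fun n => by
    rw [iteratedDeriv_add hg.1.contDiffAt hh.1.contDiffAt]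
    exact add_mem (hg.2 n) (hh.2 n)⟩

theorem mul (hg : HasTaylorIn F g) (hh : HasTaylorIn F h) : HasTaylorIn F (g * h) :=
  ⟨hg.1.mul hh.1, fun _ => iteratedDeriv_mul_mem hg.1 hh.1 (fun i _ => hg.2 i) fun i _ => hh.2 i⟩

theorem pow_id (n : ℕ) : HasTaylorIn F fun y => y ^ n := by
  induction n with
  | zero => simpa using const (one_mem F)
  | succ n ih =>
    simp only [pow_succ]
    exact ih.mul id

theorem inv (hg : HasTaylorIn F g) (h0 : g 0 ≠ 0) : HasTaylorIn F g⁻¹ := by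
  have ha : AnalyticAt ℝ g⁻¹ 0 := hg.1.inv h0
  refine ⟨ha, fun n => ?_⟩
  induction n using Nat.strong_induction_on with
  | _ n ih =>
    rcases n with _ | n
    · simpa using hg.apply_zero_mem
    have h1 : g * g⁻¹ =ᶠ[𝓝 0] fun _ => 1 := by
      filter_upwards [hg.1.continuousAt.eventually_ne h0] with y hy
      simp [hy]
    have h2 := h1.iteratedDeriv_eq (n + 1)
    rw [iteratedDeriv_mul hg.1.contDiffAt ha.contDiffAt, Finset.sum_range_succ',
      iteratedDeriv_const, if_neg n.succ_ne_zero] at h2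
    simp only [Nat.choose_zero_right, Nat.cast_one, one_mul, iteratedDeriv_zero, Nat.sub_zero]
      at h2
    rw [eq_div_of_mul_eq h0 ((mul_comm _ _).trans (eq_neg_of_add_eq_zero_right h2))]
    refine div_mem (neg_mem (sum_mem fun i hi => ?_)) hg.apply_zero_mem
    exact mul_mem (mul_mem (natCast_mem _ _) (hg.2 _)) (ih _ (by omega))

theorem sqrt (hF : ∀ c : ℝ, c ∈ F → 0 ≤ c → √c ∈ F) (hg : HasTaylorIn F g) (h0 : 0 < g 0) :
    HasTaylorIn F fun y => √(g y) := by
  have ha : AnalyticAt ℝ (fun y => √(g y)) 0 :=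
    (Real.contDiffAt_sqrt (n := ⊤) h0.ne').analyticAt.comp hg.1
  have hs : √(g 0) ≠ 0 := (Real.sqrt_pos.2 h0).ne'
  have hs' : √(g 0) ∈ F := hF _ hg.apply_zero_mem h0.le
  refine ⟨ha, fun n => ?_⟩
  induction n using Nat.strong_induction_on with
  | _ n ih =>
    rcases n with _ | n
    · simpa using hs'
    have h1 : (fun y => √(g y)) * (fun y => √(g y)) =ᶠ[𝓝 0] g := by
      filter_upwards [hg.1.continuousAt.eventually_const_lt h0] with y hy
      simp [Real.mul_self_sqrt hy.le]
    have h2 := h1.iteratedDeriv_eq (n + 1)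
    rw [iteratedDeriv_mul ha.contDiffAt ha.contDiffAt, Finset.sum_range_succ',
      Finset.sum_range_succ] at h2
    simp only [Nat.choose_zero_right, Nat.choose_self, Nat.cast_one, one_mul, iteratedDeriv_zero,
      Nat.sub_zero, Nat.sub_self] at h2
    have h3 : iteratedDeriv (n + 1) (fun y => √(g y)) 0 = (iteratedDeriv (n + 1) g 0 -
        ∑ i ∈ Finset.range n, ((n + 1).choose (i + 1) : ℝ) *
          iteratedDeriv (i + 1) (fun y => √(g y)) 0 *
          iteratedDeriv (n + 1 - (i + 1)) (fun y => √(g y)) 0) / (2 * √(g 0)) := by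
      rw [eq_div_iff (mul_ne_zero two_ne_zero hs)]
      linear_combination h2
    rw [h3]
    refine div_mem (sub_mem (hg.2 _) (sum_mem fun i hi => ?_))
      (mul_mem (ofNat_mem F 2) hs')
    have hi' := Finset.mem_range.1 hi
    exact mul_mem (mul_mem (natCast_mem _ _) (ih _ (by omega))) (ih _ (by omega))

theorem deriv (hg : HasTaylorIn F g) : HasTaylorIn F (deriv g) :=
  ⟨hg.1.deriv, fun n => by rw [← iteratedDeriv_succ']; exact hg.2 _⟩

theorem comp_sq (hg : HasTaylorIn F g) : HasTaylorIn F fun y => g (y ^ 2) := by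
  have ha : ∀ {u : ℝ → ℝ}, AnalyticAt ℝ u 0 → AnalyticAt ℝ (fun y => u (y ^ 2)) 0 := fun hu =>
    AnalyticAt.fun_comp (by simpa using hu) (analyticAt_id.pow 2)
  refine ⟨ha hg.1, fun n => ?_⟩
  induction n using Nat.strong_induction_on generalizing g with
  | _ n ih =>
    rcases n with _ | n
    · simpa using hg.apply_zero_mem
    have ht : Tendsto (fun y : ℝ => y ^ 2) (𝓝 0) (𝓝 0) := by
      simpa using (continuous_pow 2).tendsto (0 : ℝ)
    have h1 : _root_.deriv (fun y => g (y ^ 2)) =ᶠ[𝓝 0]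
        (fun y => y + y) * fun y => _root_.deriv g (y ^ 2) := by
      filter_upwards [ht.eventually hg.1.eventually_analyticAt] with y hy
      have := (HasDerivAt.comp (h := fun y : ℝ => y ^ 2) y hy.differentiableAt.hasDerivAt
        (hasDerivAt_pow 2 y)).deriv
      simp only [Function.comp_def] at this
      rw [this]
      simp
      ring
    rw [iteratedDeriv_succ', h1.iteratedDeriv_eq]
    have h2 : HasTaylorIn F fun y => y + y := id.add id
    exact iteratedDeriv_mul_mem h2.1 (ha hg.1.deriv) (fun i _ => h2.2 i)
      fun i hi => ih i (by omega) hg.deriv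

theorem eventually_zero_or_exists_pow_mul (hg : HasTaylorIn F g) :
    (∀ᶠ y in 𝓝 0, g y = 0) ∨
      ∃ (n : ℕ) (h : ℝ → ℝ), HasTaylorIn F h ∧ h 0 ≠ 0 ∧ ∀ y, g y = y ^ n * h y := by
  obtain ⟨p, hp, hpF⟩ := hg.exists_hasFPowerSeriesAt
  by_cases h0 : p = 0
  · exact .inl (hp.locally_zero_iff.2 h0)
  · refine .inr ⟨p.order, _, of_hasFPowerSeriesAt
      (hp.has_fpower_series_iterate_dslope_fslope p.order) fun n => ?_,
      hp.iterate_dslope_fslope_ne_zero h0, fun y => ?_⟩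
    · rw [FormalMultilinearSeries.coeff_iterate_fslope]
      exact hpF _
    · simpa using hp.eq_pow_order_mul_iterate_dslope y

end HasTaylorIn

namespace HasLaurentIn

variable {F : Subfield ℝ} {φ ψ : ℝ → ℝ}

theorem of_hasTaylorIn (hφ : HasTaylorIn F φ) : HasLaurentIn F φ :=
  ⟨0, φ, hφ, by simp⟩

theorem eventually_zero_or_exists_ne_zero (hφ : HasLaurentIn F φ) :
    (∀ᶠ y in 𝓝[>] 0, φ y = 0) ∨ ∃ (t : ℤ) (g : ℝ → ℝ), HasTaylorIn F g ∧ g 0 ≠ 0 ∧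
      φ =ᶠ[𝓝[>] 0] fun y => y ^ t * g y := by
  obtain ⟨t, g, hg, hφg⟩ := hφ
  rcases hg.eventually_zero_or_exists_pow_mul with h | ⟨n, h, hh, h0, hgh⟩
  · left
    filter_upwards [hφg, nhdsWithin_le_nhds h] with y hy hy'
    simp [hy, hy']
  · refine .inr ⟨t + n, h, hh, h0, ?_⟩
    filter_upwards [hφg, self_mem_nhdsWithin] with y hy hy0
    rw [hy, hgh, zpow_add₀ (ne_of_gt hy0), zpow_natCast, mul_assoc]

theorem mul (hφ : HasLaurentIn F φ) (hψ : HasLaurentIn F ψ) :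
    HasLaurentIn F fun y => φ y * ψ y := by
  obtain ⟨s, g, hg, hφ⟩ := hφ
  obtain ⟨t, h, hh, hψ⟩ := hψ
  refine ⟨s + t, g * h, hg.mul hh, ?_⟩
  filter_upwards [hφ, hψ, self_mem_nhdsWithin] with y h1 h2 hy0
  rw [h1, h2, zpow_add₀ (ne_of_gt hy0), Pi.mul_apply]
  ring

theorem add (hφ : HasLaurentIn F φ) (hψ : HasLaurentIn F ψ) :
    HasLaurentIn F fun y => φ y + ψ y := by
  obtain ⟨s, g, hg, hφ⟩ := hφ
  obtain ⟨t, h, hh, hψ⟩ := hψ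
  refine ⟨min s t, _, ((HasTaylorIn.pow_id (s - min s t).toNat).mul hg).add
    ((HasTaylorIn.pow_id (t - min s t).toNat).mul hh), ?_⟩
  filter_upwards [hφ, hψ, self_mem_nhdsWithin] with y h1 h2 hy0
  have key : ∀ r : ℤ, min s t ≤ r → y ^ r = y ^ min s t * y ^ (r - min s t).toNat := by
    intro r hr
    rw [← zpow_natCast, ← zpow_add₀ (ne_of_gt hy0), Int.toNat_of_nonneg (by omega)]
    congr 1
    ring
  rw [h1, h2, key s (min_le_left _ _), key t (min_le_right _ _)]
  simp only [Pi.add_apply, Pi.mul_apply]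
  ring

theorem inv (hφ : HasLaurentIn F φ) : HasLaurentIn F fun y => (φ y)⁻¹ := by
  rcases hφ.eventually_zero_or_exists_ne_zero with h | ⟨t, g, hg, h0, h⟩
  · refine ⟨0, _, .const (zero_mem F), ?_⟩
    filter_upwards [h] with y hy
    simp [hy]
  · refine ⟨-t, _, hg.inv h0, ?_⟩
    filter_upwards [h] with y hy
    simp [hy, mul_comm]

theorem sqrt_comp_sq (hF : ∀ c : ℝ, c ∈ F → 0 ≤ c → √c ∈ F) (hφ : HasLaurentIn F φ)
    (hnonneg : ∀ᶠ y in 𝓝[>] 0, 0 ≤ φ y) : HasLaurentIn F fun y => √(φ (y ^ 2)) := by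
  have hsq := tendsto_pow_nhdsGT_zero two_ne_zero
  rcases hφ.eventually_zero_or_exists_ne_zero with h | ⟨t, g, hg, h0, h⟩
  · refine ⟨0, _, .const (zero_mem F), ?_⟩
    filter_upwards [hsq.eventually h] with y hy
    simp [hy]
  · have hpos : 0 < g 0 := by
      refine lt_of_le_of_ne (ge_of_tendsto
        (hg.1.continuousAt.tendsto.mono_left (nhdsWithin_le_nhds (s := Set.Ioi 0))) ?_) h0.symm
      filter_upwards [h, hnonneg, self_mem_nhdsWithin] with y hy hy' hy0
      rw [hy] at hy'
      exact nonneg_of_mul_nonneg_right hy' (zpow_pos hy0 t)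
    refine ⟨t, _, (hg.sqrt hF hpos).comp_sq, ?_⟩
    filter_upwards [hsq.eventually h, self_mem_nhdsWithin] with y hy hy0
    have hy0 : 0 < y := hy0
    rw [hy, ← zpow_natCast, zpow_comm, zpow_natCast, Real.sqrt_mul (by positivity),
      Real.sqrt_sq (by positivity)]

end HasLaurentIn

theorem SqExpr.hasLaurentIn_val {F : Subfield ℝ} (hF : ∀ c : ℝ, c ∈ F → 0 ≤ c → √c ∈ F)
    {ε : ℝ} (hε : 0 < ε) (e : SqExpr F) (hwd : e.WellDefOn (Set.Ioo 0 ε)) {k : ℕ}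
    (hk : e.depth ≤ k) : HasLaurentIn F fun y => e.val (y ^ 2 ^ k) := by
  induction e generalizing k with
  | const c => exact .of_hasTaylorIn (.const c.2)
  | var => exact .of_hasTaylorIn (.pow_id _)
  | add e₁ e₂ ih₁ ih₂ =>
    exact (ih₁ hwd.1 ((le_max_left _ _).trans hk)).add (ih₂ hwd.2 ((le_max_right _ _).trans hk))
  | sub e₁ e₂ ih₁ ih₂ =>
    have h := (ih₁ hwd.1 ((le_max_left _ _).trans hk)).add
      ((HasLaurentIn.of_hasTaylorIn (.const (neg_mem (one_mem F)))).mul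
        (ih₂ hwd.2 ((le_max_right _ _).trans hk)))
    simpa [SqExpr.val, sub_eq_add_neg] using h
  | mul e₁ e₂ ih₁ ih₂ =>
    exact (ih₁ hwd.1 ((le_max_left _ _).trans hk)).mul (ih₂ hwd.2 ((le_max_right _ _).trans hk))
  | div e₁ e₂ ih₁ ih₂ =>
    have h := (ih₁ hwd.1 ((le_max_left _ _).trans hk)).mul
      (ih₂ hwd.2.1 ((le_max_right _ _).trans hk)).inv
    simpa [SqExpr.val, div_eq_mul_inv] using h
  | sqrt e ih =>
    obtain ⟨m, rfl⟩ : ∃ m, k = m + 1 := ⟨k - 1, by simp only [SqExpr.depth] at hk; omega⟩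
    have hm : e.depth ≤ m := Nat.le_of_succ_le_succ hk
    have h := (ih hwd.1 hm).sqrt_comp_sq hF <| by
      filter_upwards [(tendsto_pow_nhdsGT_zero (pow_ne_zero m two_ne_zero)).eventually
        (Ioo_mem_nhdsGT hε)] with y hy
      exact hwd.2 _ hy
    simpa only [SqExpr.val, ← pow_mul, ← pow_succ'] using h

theorem rpow_pow_two_pow_div {y : ℝ} (hy : 0 < y) (k : ℕ) (t : ℤ) (n : ℕ) :
    (y ^ 2 ^ k) ^ (((t + n : ℤ) : ℝ) / 2 ^ k) = y ^ t * y ^ n := by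
  rw [← Real.rpow_natCast, ← Real.rpow_mul hy.le, Nat.cast_pow, Nat.cast_ofNat,
    mul_div_cancel₀ _ (by positivity), Real.rpow_intCast, zpow_add₀ hy.ne', zpow_natCast]

/-- A Laurent-type representation in the variable `x ^ (1 / 2 ^ k)` gives an expansion. -/
theorem HasFPowerSeriesAt.exists_expandsOn {f g : ℝ → ℝ} {k : ℕ} {t : ℤ}
    {p : FormalMultilinearSeries ℝ ℝ ℝ} (hp : HasFPowerSeriesAt g p 0)
    (hf : (fun y => f (y ^ 2 ^ k)) =ᶠ[𝓝[>] 0] fun y => y ^ t * g y) {ε : ℝ} (hε : 0 < ε) :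
    ∃ ε' : ℝ, 0 < ε' ∧ ε' ≤ ε ∧ ExpandsOn f k t (fun j => p.coeff (j - t).toNat) ε' := by
  have hroot := tendsto_rpow_nhdsGT_zero (a := ((2 ^ k : ℕ) : ℝ)⁻¹) (by positivity)
  have hsum := nhdsWithin_le_nhds (s := Set.Ioi 0) (hasFPowerSeriesAt_iff'.1 hp)
  obtain ⟨u, hu, hsub⟩ := mem_nhdsGT_iff_exists_Ioo_subset.1 (hroot.eventually (hf.and hsum))
  refine ⟨min u ε, lt_min hu hε, min_le_right _ _, fun x hx => ?_⟩
  obtain ⟨h1, h2⟩ := hsub ⟨hx.1, hx.2.trans_le (min_le_left _ _)⟩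
  have hy : 0 < x ^ ((2 ^ k : ℕ) : ℝ)⁻¹ := Real.rpow_pos_of_pos hx.1 _
  have hxy : (x ^ ((2 ^ k : ℕ) : ℝ)⁻¹) ^ 2 ^ k = x :=
    Real.rpow_inv_natCast_pow hx.1.le (by positivity)
  generalize x ^ ((2 ^ k : ℕ) : ℝ)⁻¹ = y at h1 h2 hy hxy
  subst hxy
  simp only at h1
  rw [h1]
  refine (h2.tendsto_sum_nat.const_mul (y ^ t)).congr fun N => ?_
  rw [Finset.mul_sum]
  refine Finset.sum_congr rfl fun j _ => ?_
  rw [rpow_pow_two_pow_div hy]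
  simp only [sub_zero, smul_eq_mul, add_sub_cancel_left, Int.toNat_natCast]
  ring

/-- An expansion comes from a Laurent-type representation in the variable `x ^ (1 / 2 ^ k)`. -/
theorem ExpandsOn.exists_hasFPowerSeriesAt {f : ℝ → ℝ} {k : ℕ} {t : ℤ} {b : ℤ → ℝ} {ε : ℝ}
    (h : ExpandsOn f k t b ε) (hε : 0 < ε) :
    ∃ (g : ℝ → ℝ) (p : FormalMultilinearSeries ℝ ℝ ℝ), HasFPowerSeriesAt g p 0 ∧
      (∀ n : ℕ, p.coeff n = b (t + n)) ∧
      (fun y => f (y ^ 2 ^ k)) =ᶠ[𝓝[>] 0] fun y => y ^ t * g y := by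
  have hlt : ∀ᶠ y : ℝ in 𝓝[>] 0, y ^ 2 ^ k ∈ Set.Ioo 0 ε :=
    (tendsto_pow_nhdsGT_zero (pow_ne_zero k two_ne_zero)).eventually (Ioo_mem_nhdsGT hε)
  have hlim : ∀ y : ℝ, 0 < y → y ^ 2 ^ k ∈ Set.Ioo 0 ε →
      Tendsto (fun N : ℕ => ∑ j ∈ Finset.range N, y ^ j * b (t + j)) atTop
        (𝓝 ((y ^ t)⁻¹ * f (y ^ 2 ^ k))) := by
    intro y hy hy'
    refine ((h _ hy').const_mul (y ^ t)⁻¹).congr fun N => ?_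
    rw [Finset.mul_sum]
    refine Finset.sum_congr rfl fun j _ => ?_
    rw [rpow_pow_two_pow_div hy]
    have := (zpow_pos hy t).ne'
    field_simp
  let p := FormalMultilinearSeries.ofScalars ℝ fun n : ℕ => b (t + n)
  have hpc : ∀ n : ℕ, p.coeff n = b (t + n) := fun n =>
    FormalMultilinearSeries.coeff_ofScalars
  obtain ⟨r, hr, hr0⟩ := (hlt.and self_mem_nhdsWithin).exists
  have hr0 : 0 < r := hr0
  have hrad : 0 < p.radius := by
    have hterm : Tendsto (fun n : ℕ => r ^ n * b (t + n)) atTop (𝓝 0) := by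
      have h1 := hlim r hr0 hr
      simpa [Finset.sum_range_succ] using (h1.comp (tendsto_add_atTop_nat 1)).sub h1
    refine lt_of_lt_of_le (ENNReal.coe_pos.2 hr0) (p.le_radius_of_tendsto (r := ⟨r, hr0.le⟩)
      (l := 0) (hterm.norm.congr' ?_ |>.trans (by simp)))
    filter_upwards with n
    rw [FormalMultilinearSeries.norm_apply_eq_norm_coef, hpc, norm_mul, norm_pow,
      Real.norm_of_nonneg hr0.le, mul_comm]
    rfl
  have hp := (p.hasFPowerSeriesOnBall hrad).hasFPowerSeriesAt
  refine ⟨p.sum, p, hp, hpc, ?_⟩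
  filter_upwards [hlt, nhdsWithin_le_nhds (hasFPowerSeriesAt_iff'.1 hp), self_mem_nhdsWithin]
    with y hy hsum hy0
  simp only [sub_zero, smul_eq_mul, hpc] at hsum
  rw [tendsto_nhds_unique hsum.tendsto_sum_nat (hlim y hy0 hy),
    mul_inv_cancel_left₀ (zpow_pos hy0 t).ne']

theorem HasFPowerSeriesAt.unique_of_zpow_mul {g g' : ℝ → ℝ}
    {p p' : FormalMultilinearSeries ℝ ℝ ℝ} (hp : HasFPowerSeriesAt g p 0)
    (hp' : HasFPowerSeriesAt g' p' 0) (h0 : p.coeff 0 ≠ 0) (h0' : p'.coeff 0 ≠ 0) {t t' : ℤ}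
    (h : (fun y => y ^ t * g y) =ᶠ[𝓝[>] 0] fun y => y ^ t' * g' y) : t' = t ∧ p' = p := by
  wlog htt : t ≤ t' generalizing g g' p p' t t'
  · obtain ⟨h1, h2⟩ := this hp' hp h0' h0 h.symm (le_of_not_ge htt)
    exact ⟨h1.symm, h2.symm⟩
  obtain ⟨n, rfl⟩ := Int.le.dest htt
  have hev : ∀ᶠ y in 𝓝[>] (0 : ℝ), g y = y ^ n * g' y := by
    filter_upwards [h, self_mem_nhdsWithin] with y hy hy0
    rw [zpow_add₀ (ne_of_gt hy0), mul_assoc, zpow_natCast] at hy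
    exact mul_left_cancel₀ (zpow_pos hy0 t).ne' hy
  have hev' : ∀ᶠ y in 𝓝 (0 : ℝ), g y = y ^ n * g' y :=
    (hp.analyticAt.frequently_eq_iff_eventually_eq
      ((analyticAt_id.pow n).mul hp'.analyticAt)).1
      (hev.frequently.filter_mono (nhdsWithin_mono _ fun y hy => ne_of_gt hy))
  have hg0 : g 0 ≠ 0 := by
    rw [← hp.coeff_zero 1]
    exact h0
  rcases Nat.eq_zero_or_pos n with rfl | hn
  · refine ⟨by simp, hp'.eq_formalMultilinearSeries_of_eventually hp ?_⟩
    filter_upwards [hev'] with y hy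
    simp [hy]
  · exact absurd hev'.self_of_nhds (by simpa [hn.ne'] using hg0)

/-- Real square-root-closed analogue of Puiseux's theorem: if `F ⊆ ℝ` is closed under
real square roots and `f` is represented on `(0, ε)` by a well-defined expression over
`F` of square-root depth at most `k`, then `f` admits a generalized power series
expansion `Σ_{j=t}^∞ b_j x^{j·2^{−k}}` with coefficients in `F` on some strict right
neighborhood of `0`; moreover, if `f` does not vanish identically on any right
neighborhood of `0`, the expansion can be chosen with `b_t ≠ 0`, and then `t` and the
coefficients `b_j` (for `j ≥ t`) are uniquely determined. -/
theorem statement13 (F : Subfield ℝ)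
    (hF : ∀ c : ℝ, c ∈ F → 0 ≤ c → Real.sqrt c ∈ F)
    (k : ℕ) (ε : ℝ) (hε : 0 < ε) (f : ℝ → ℝ) (e : SqExpr F)
    (hdepth : e.depth ≤ k) (hwd : e.WellDefOn (Set.Ioo 0 ε))
    (hfe : ∀ x ∈ Set.Ioo (0 : ℝ) ε, f x = e.val x) :
    (∃ (t : ℤ) (b : ℤ → ℝ), (∀ j, b j ∈ F) ∧
       ∃ ε' : ℝ, 0 < ε' ∧ ε' ≤ ε ∧ ExpandsOn f k t b ε') ∧
    ((∀ δ : ℝ, 0 < δ → ∃ x ∈ Set.Ioo (0 : ℝ) (min δ ε), f x ≠ 0) →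
      ∃ (t : ℤ) (b : ℤ → ℝ), b t ≠ 0 ∧ (∀ j, b j ∈ F) ∧
        (∃ ε' : ℝ, 0 < ε' ∧ ε' ≤ ε ∧ ExpandsOn f k t b ε') ∧
        ∀ (t' : ℤ) (b' : ℤ → ℝ), b' t' ≠ 0 → (∀ j, b' j ∈ F) →
          (∃ ε'' : ℝ, 0 < ε'' ∧ ε'' ≤ ε ∧ ExpandsOn f k t' b' ε'') →
          t' = t ∧ ∀ j : ℤ, t ≤ j → b' j = b j) := by
  have hval := e.hasLaurentIn_val hF hε hwd hdepth
  have hev : ∀ᶠ y : ℝ in 𝓝[>] 0, y ^ 2 ^ k ∈ Set.Ioo 0 ε :=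
    (tendsto_pow_nhdsGT_zero (pow_ne_zero k two_ne_zero)).eventually (Ioo_mem_nhdsGT hε)
  have hfval : (fun y => f (y ^ 2 ^ k)) =ᶠ[𝓝[>] 0] fun y => e.val (y ^ 2 ^ k) := by
    filter_upwards [hev] with y hy using hfe _ hy
  constructor
  · obtain ⟨t, g, hg, h⟩ := hval
    obtain ⟨p, hp, hpF⟩ := hg.exists_hasFPowerSeriesAt
    exact ⟨t, _, fun j => hpF _, hp.exists_expandsOn (hfval.trans h) hε⟩
  · intro hne
    rcases hval.eventually_zero_or_exists_ne_zero with h | ⟨t, g, hg, hg0, h⟩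
    · have hroot := tendsto_rpow_nhdsGT_zero (a := ((2 ^ k : ℕ) : ℝ)⁻¹) (by positivity)
      obtain ⟨δ, hδ, hsub⟩ := mem_nhdsGT_iff_exists_Ioo_subset.1
        (hroot.eventually (hfval.trans h))
      obtain ⟨x, hx, hfx⟩ := hne δ hδ
      have hx0 := hsub ⟨hx.1, hx.2.trans_le (min_le_left _ _)⟩
      simp only [Set.mem_ofPred_eq, Real.rpow_inv_natCast_pow hx.1.le (pow_ne_zero k two_ne_zero)]
        at hx0
      exact absurd hx0 hfx
    · obtain ⟨p, hp, hpF⟩ := hg.exists_hasFPowerSeriesAt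
      have hp0 : p.coeff 0 ≠ 0 := by
        rw [← hp.coeff_zero 1] at hg0
        exact hg0
      refine ⟨t, fun j => p.coeff (j - t).toNat, by simpa using hp0, fun j => hpF _,
        hp.exists_expandsOn (hfval.trans h) hε, ?_⟩
      rintro t' b' hb' - ⟨ε', hε', -, hexp⟩
      obtain ⟨g', p', hp', hpc, h'⟩ := hexp.exists_hasFPowerSeriesAt hε'
      obtain ⟨rfl, rfl⟩ := hp.unique_of_zpow_mul hp' hp0 (by simpa [hpc] using hb')
        ((hfval.trans h).symm.trans h')
      refine ⟨rfl, fun j hj => ?_⟩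
      simp only [hpc, Int.toNat_of_nonneg (sub_nonneg.2 hj), add_sub_cancel]
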